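/- Let j ∈ [n] and m ∈ ℕ be such that 2m ≥ n − j + 2, and let i₁, i₂, …, i_m be m (not necessarily distinct) elements of [j]. Then in k[S_n] we have [t_{i₁}, t_j] · [t_{i₂}, t_j] · ⋯ · [t_{i_m}, t_j] = 0. -/

import Mathlib

/-- The simple transposition `s_i ∈ S_n` (1-based indexing), swapping `i` and `i+1`,
defined as the identity for `i` outside `{1, …, n-1}`. -/
def simpleTransposition (n i : ℕ) : Equiv.Perm (Fin n) :=
  if h : 1 ≤ i ∧ i < n then
    Equiv.swap ⟨i - 1, by omega⟩ ⟨i, h.2⟩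
  else 1

/-- The cycle `(v ⟹ w) = s_v s_{v+1} ⋯ s_{w-1} ∈ S_n`, sending
`v ↦ v+1 ↦ ⋯ ↦ w ↦ v` (and equal to the identity when `v = w`). -/
def cyc (n v w : ℕ) : Equiv.Perm (Fin n) :=
  ((List.range' v (w - v)).map (simpleTransposition n)).prod

/-- The somewhere-to-below shuffle `t_ℓ = Σ_{w=ℓ}^{n} (ℓ ⟹ w)` in the group
algebra `R[S_n]`. -/
noncomputable def t (R : Type*) [CommRing R] (n ℓ : ℕ) :
    MonoidAlgebra R (Equiv.Perm (Fin n)) :=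
  ∑ w ∈ Finset.Icc ℓ n, MonoidAlgebra.of R (Equiv.Perm (Fin n)) (cyc n ℓ w)

/-- The simple transposition `s_u`, viewed in the group algebra. -/
noncomputable def simpleElt (R : Type*) [CommRing R] (n u : ℕ) :
    MonoidAlgebra R (Equiv.Perm (Fin n)) :=
  MonoidAlgebra.of R (Equiv.Perm (Fin n)) (simpleTransposition n u)

/-- The product `(1 - s_a) (1 - s_{a+2}) ⋯ (1 - s_{a+2(m-1)})` of `m` commuting antisymmetrizers. -/
noncomputable def antisymProd (R : Type*) [CommRing R] (n : ℕ) :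
    ℕ → ℕ → MonoidAlgebra R (Equiv.Perm (Fin n))
  | _, 0 => 1
  | a, m + 1 => (1 - simpleElt R n a) * antisymProd R n (a + 2) m

section Permutations

variable {n : ℕ}

theorem simpleTransposition_mul_self (u : ℕ) :
    simpleTransposition n u * simpleTransposition n u = 1 := by
  unfold simpleTransposition
  split_ifs <;> simp

theorem simpleTransposition_of_le {u : ℕ} (h : n ≤ u) : simpleTransposition n u = 1 :=
  dif_neg (by omega)

theorem simpleTransposition_commute {u v : ℕ} (h : u + 2 ≤ v) :
    Commute (simpleTransposition n u) (simpleTransposition n v) := by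
  unfold simpleTransposition
  split_ifs with hu hv
  · refine (Equiv.Perm.disjoint_swap_swap ?_).commute
    simp only [List.nodup_cons, List.mem_cons, Fin.mk.injEq, List.not_mem_nil]
    grind
  all_goals simp

theorem simpleTransposition_braid {u : ℕ} (hu : 1 ≤ u) (h : u + 1 < n) :
    simpleTransposition n u * simpleTransposition n (u + 1) * simpleTransposition n u =
      simpleTransposition n (u + 1) * simpleTransposition n u *
        simpleTransposition n (u + 1) := by
  rw [simpleTransposition, simpleTransposition, dif_pos ⟨hu, by omega⟩,
    dif_pos ⟨by omega, h⟩]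
  ext x
  simp only [Equiv.Perm.mul_apply, Equiv.swap_apply_def, Fin.ext_iff]
  grind

theorem cyc_self (v : ℕ) : cyc n v v = 1 := by
  simp [cyc]

theorem cyc_eq_mul {v w : ℕ} (h : v < w) :
    cyc n v w = simpleTransposition n v * cyc n (v + 1) w := by
  obtain ⟨d, rfl⟩ := Nat.exists_eq_add_of_lt h
  simp [cyc, show v + d + 1 - v = d + 1 by omega, show v + d + 1 - (v + 1) = d by omega,
    List.range'_succ]

theorem simpleTransposition_commute_cyc {u v : ℕ} (h : u + 2 ≤ v) (w : ℕ) :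
    Commute (simpleTransposition n u) (cyc n v w) := by
  refine Commute.list_prod_right _ _ fun x hx => ?_
  obtain ⟨k, hk, rfl⟩ := List.mem_map.mp hx
  exact simpleTransposition_commute (h.trans (List.mem_range'_1.mp hk).1)

end Permutations

section GroupAlgebra

variable (R : Type*) [CommRing R] {n : ℕ}

theorem simpleElt_mul_self (u : ℕ) : simpleElt R n u * simpleElt R n u = 1 := by
  rw [simpleElt, ← map_mul, simpleTransposition_mul_self, map_one]

theorem simpleElt_of_le {u : ℕ} (h : n ≤ u) : simpleElt R n u = 1 := by
  rw [simpleElt, simpleTransposition_of_le h, map_one]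

theorem simpleElt_commute {u v : ℕ} (h : u + 2 ≤ v) :
    Commute (simpleElt R n u) (simpleElt R n v) :=
  (simpleTransposition_commute h).map _

theorem simpleElt_braid {u : ℕ} (hu : 1 ≤ u) (h : u + 1 < n) :
    simpleElt R n u * simpleElt R n (u + 1) * simpleElt R n u =
      simpleElt R n (u + 1) * simpleElt R n u * simpleElt R n (u + 1) := by
  simp only [simpleElt, ← map_mul, simpleTransposition_braid hu h]

theorem simpleElt_commute_t {u v : ℕ} (h : u + 2 ≤ v) :
    Commute (simpleElt R n u) (t R n v) :=
  Commute.sum_right _ _ _ fun w _ => (simpleTransposition_commute_cyc h w).map _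

theorem t_of_lt {v : ℕ} (h : n < v) : t R n v = 0 := by
  simp [t, Finset.Icc_eq_empty_of_lt h]

theorem t_eq_one_add {v : ℕ} (h : v ≤ n) :
    t R n v = 1 + simpleElt R n v * t R n (v + 1) := by
  have hsum : ∑ w ∈ Finset.Icc (v + 1) n, MonoidAlgebra.of R (Equiv.Perm (Fin n)) (cyc n v w) =
      simpleElt R n v * t R n (v + 1) := by
    rw [t, Finset.mul_sum]
    refine Finset.sum_congr rfl fun w hw => ?_
    rw [cyc_eq_mul (Finset.mem_Icc.mp hw).1, map_mul, simpleElt]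
  rw [← hsum, t, ← Finset.insert_Icc_add_one_left_eq_Icc h, Finset.sum_insert (by simp),
    cyc_self, map_one]

theorem t_self : t R n n = 1 := by
  rw [t_eq_one_add R le_rfl, t_of_lt R n.lt_succ_self, mul_zero, add_zero]

/-- Equivalently, `t_{j+1} t_j = (t_j - 1) t_j`. -/
theorem simpleElt_mul_t_succ_mul_t {j : ℕ} (hj : 1 ≤ j) (h : j < n) :
    simpleElt R n j * (t R n (j + 1) * t R n j) = t R n (j + 1) * t R n j := by
  obtain ⟨d, rfl⟩ := Nat.exists_eq_add_of_lt h
  induction d generalizing j with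
  | zero =>
    rw [t_eq_one_add R h.le, add_zero, t_self, mul_one, one_mul, mul_add, mul_one,
      simpleElt_mul_self, add_comm (1 : MonoidAlgebra R _)]
  | succ d ih =>
    have e : j + (d + 1) + 1 = j + 1 + d + 1 := by omega
    rw [e] at h ⊢
    have hc := ih (j := j + 1) (by omega) (by omega)
    have hbb := simpleElt_mul_self R (n := j + 1 + d + 1) j
    have hbr := simpleElt_braid R (n := j + 1 + d + 1) hj (by omega)
    have hU := (simpleElt_commute_t R (n := j + 1 + d + 1) (u := j) le_rfl).eq
    have hX := t_eq_one_add R (n := j + 1 + d + 1) (v := j + 1) (by omega)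
    rw [t_eq_one_add R h.le]
    set b := simpleElt R (j + 1 + d + 1) j
    set c := simpleElt R (j + 1 + d + 1) (j + 1)
    set X := t R (j + 1 + d + 1) (j + 1)
    set U := t R (j + 1 + d + 1) (j + 1 + 1)
    have key : X * (1 + b * X) = X + b * X + c * b * (U * X) := by
      calc X * (1 + b * X) = X + X * (b * X) := by noncomm_ring
        _ = X + (1 + c * U) * (b * X) := by rw [← hX]
        _ = X + b * X + c * (U * b) * X := by noncomm_ring
        _ = X + b * X + c * b * (U * X) := by rw [← hU]; noncomm_ring
    rw [key]
    calc b * (X + b * X + c * b * (U * X))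
        = b * X + b * b * X + b * c * b * (U * X) := by noncomm_ring
      _ = X + b * X + c * b * (c * (U * X)) := by rw [hbb, hbr]; noncomm_ring
      _ = X + b * X + c * b * (U * X) := by rw [hc]

theorem commute_antisymProd {x : MonoidAlgebra R (Equiv.Perm (Fin n))} {a : ℕ}
    (h : ∀ u, a ≤ u → Commute x (simpleElt R n u)) (m : ℕ) :
    Commute x (antisymProd R n a m) := by
  induction m generalizing a with
  | zero => exact Commute.one_right x
  | succ m ih =>
    exact ((Commute.one_right x).sub_right (h a le_rfl)).mul_right
      (ih fun u hu => h u (by omega))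

theorem antisymProd_eq_zero {a m : ℕ} (hm : 1 ≤ m) (h : n + 2 ≤ a + 2 * m) :
    antisymProd R n a m = 0 := by
  induction m generalizing a with
  | zero => omega
  | succ m ih =>
    rw [antisymProd]
    rcases Nat.eq_zero_or_pos m with rfl | hm'
    · rw [simpleElt_of_le R (by omega), sub_self, zero_mul]
    · rw [ih hm' (by omega), mul_zero]

theorem antisymProd_succ_dvd_t_mul {a : ℕ} (ha : 1 ≤ a) (m : ℕ) :
    antisymProd R n (a + 1) m ∣ t R n a * antisymProd R n a m := by
  induction m generalizing a with
  | zero => exact one_dvd _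
  | succ m ih =>
    have hbb := simpleElt_mul_self R (n := n) a
    rcases lt_trichotomy (a + 1) n with h | rfl | h
    · obtain ⟨y, hy⟩ := ih (a := a + 2) (by omega)
      have hbr := simpleElt_braid R ha h
      have hU := (simpleElt_commute_t R (n := n) (u := a) le_rfl).eq
      have hP : Commute (simpleElt R n a * simpleElt R n (a + 1))
          (antisymProd R n (a + 2 + 1) m) :=
        commute_antisymProd R (fun u hu => (simpleElt_commute R (by omega)).mul_left
          (simpleElt_commute R (by omega))) m
      refine ⟨simpleElt R n a * simpleElt R n (a + 1) * y, ?_⟩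
      rw [antisymProd, antisymProd, t_eq_one_add R (by omega : a ≤ n), t_eq_one_add R h.le]
      set b := simpleElt R n a
      set c := simpleElt R n (a + 1)
      set U := t R n (a + 2)
      set P := antisymProd R n (a + 2) m
      set Q := antisymProd R n (a + 2 + 1) m
      calc (1 + b * (1 + c * U)) * ((1 - b) * P)
          = (1 - b * b) * P + b * c * U * P - b * c * (U * b) * P := by noncomm_ring
        _ = (b * c - b * c * b) * (U * P) := by rw [hbb, ← hU]; noncomm_ring
        _ = (1 - c) * (b * c * Q) * y := by rw [hbr, hy]; noncomm_ring
        _ = (1 - c) * Q * (b * c * y) := by rw [hP.eq]; noncomm_ring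
    · refine ⟨0, ?_⟩
      rw [mul_zero, antisymProd, t_eq_one_add R (by omega), t_self, mul_one, ← mul_assoc]
      rw [show (1 + simpleElt R (a + 1) a) * (1 - simpleElt R (a + 1) a) =
        1 - simpleElt R (a + 1) a * simpleElt R (a + 1) a by noncomm_ring, hbb, sub_self, zero_mul]
    · rw [antisymProd_eq_zero R (a := a) (by omega) (by omega), mul_zero]
      exact dvd_zero _

theorem antisymProd_dvd_t_sub_one_mul {a : ℕ} (h : a ≤ n) (m : ℕ) :
    antisymProd R n (a + 2) m ∣ (t R n a - 1) * antisymProd R n (a + 1) m := by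
  obtain ⟨y, hy⟩ := antisymProd_succ_dvd_t_mul R (n := n) (a := a + 1) (by omega) m
  refine ⟨simpleElt R n a * y, ?_⟩
  have hP : Commute (simpleElt R n a) (antisymProd R n (a + 2) m) :=
    commute_antisymProd R (fun u hu => simpleElt_commute R hu) m
  rw [t_eq_one_add R h, add_sub_cancel_left, mul_assoc, hy, ← mul_assoc, hP.eq, mul_assoc]

/-- The factorization `[t_i, t_j] = (1 - s_j) y (t_j - 1) t_j` (where in fact
`y = s_i s_{i+1} ⋯ s_{j-1}` for `i < j`). -/
theorem exists_commutator_eq {i j : ℕ} (hi : 1 ≤ i) (hij : i ≤ j) (hj : j ≤ n) :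
    ∃ y : MonoidAlgebra R (Equiv.Perm (Fin n)),
      (∀ u, j + 1 ≤ u → Commute y (simpleElt R n u)) ∧
      t R n i * t R n j - t R n j * t R n i =
        (1 - simpleElt R n j) * y * ((t R n j - 1) * t R n j) := by
  rcases hj.eq_or_lt with rfl | hj
  · exact ⟨0, fun u _ => Commute.zero_left _, by simp [t_self]⟩
  rcases hij.eq_or_lt with rfl | hij
  · exact ⟨0, fun u _ => Commute.zero_left _, by simp⟩
  obtain ⟨d, rfl⟩ := Nat.exists_eq_add_of_lt hij
  induction d generalizing i with
  | zero =>
    rw [add_zero] at *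
    refine ⟨simpleElt R n i, fun u hu => simpleElt_commute R (by omega), ?_⟩
    have hid := simpleElt_mul_t_succ_mul_t R (n := n) (j := i + 1) (by omega) hj
    have hbr := simpleElt_braid R (n := n) hi hj
    have hT := (simpleElt_commute_t R (n := n) (u := i) le_rfl).eq
    have ht := t_eq_one_add R (n := n) (v := i + 1) hj.le
    rw [t_eq_one_add R (by omega : i ≤ n)]
    set a := simpleElt R n i
    set b := simpleElt R n (i + 1)
    set T := t R n (i + 1 + 1)
    set X := t R n (i + 1)
    have hX : X - 1 = b * T := by rw [ht]; noncomm_ring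
    calc (1 + a * X) * X - X * (1 + a * X)
        = a * (X - 1) * X - (X - 1) * a * X := by noncomm_ring
      _ = a * b * (T * X) - b * (T * a) * X := by rw [hX]; noncomm_ring
      _ = a * b * (T * X) - b * a * (T * X) := by rw [← hT]; noncomm_ring
      _ = a * b * (T * X) - b * a * (b * (T * X)) := by rw [hid]
      _ = (1 - b) * a * ((X - 1) * X) := by rw [hX]; noncomm_ring
  | succ d ih =>
    have e : i + (d + 1) + 1 = i + 1 + d + 1 := by omega
    rw [e] at hj ⊢
    obtain ⟨y, hy, hcomm⟩ := ih (i := i + 1) (by omega) (by omega) hj.le hj (by omega)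
    refine ⟨simpleElt R n i * y,
      fun u hu => (simpleElt_commute R (by omega)).mul_left (hy u hu), ?_⟩
    have hX := (simpleElt_commute_t R (n := n) (u := i) (v := i + 1 + d + 1) (by omega)).eq
    have hs := (simpleElt_commute R (n := n) (u := i) (v := i + 1 + d + 1) (by omega)).eq
    rw [t_eq_one_add R (by omega : i ≤ n)]
    set a := simpleElt R n i
    set s := simpleElt R n (i + 1 + d + 1)
    set X := t R n (i + 1 + d + 1)
    set Y := t R n (i + 1)
    calc (1 + a * Y) * X - X * (1 + a * Y) = a * (Y * X) - X * a * Y := by noncomm_ring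
      _ = a * (Y * X - X * Y) := by rw [← hX]; noncomm_ring
      _ = (a - a * s) * y * ((X - 1) * X) := by rw [hcomm]; noncomm_ring
      _ = (1 - s) * (a * y) * ((X - 1) * X) := by rw [hs]; noncomm_ring

theorem antisymProd_dvd_commutator_mul {i j : ℕ} (hi : 1 ≤ i) (hij : i ≤ j) (hj : j ≤ n)
    (m : ℕ) :
    antisymProd R n j (m + 1) ∣
      (t R n i * t R n j - t R n j * t R n i) * antisymProd R n j m := by
  obtain ⟨y, hy, h⟩ := exists_commutator_eq R hi hij hj
  obtain ⟨p, hp⟩ := antisymProd_succ_dvd_t_mul R (n := n) (hi.trans hij) m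
  obtain ⟨q, hq⟩ := antisymProd_dvd_t_sub_one_mul R hj m
  have hP : Commute y (antisymProd R n (j + 2) m) :=
    commute_antisymProd R (fun u hu => hy u (by omega)) m
  refine ⟨y * q * p, ?_⟩
  rw [h, antisymProd]
  calc (1 - simpleElt R n j) * y * ((t R n j - 1) * t R n j) * antisymProd R n j m
      = (1 - simpleElt R n j) * y * ((t R n j - 1) * (t R n j * antisymProd R n j m)) := by
        simp only [mul_assoc]
    _ = (1 - simpleElt R n j) * (y * antisymProd R n (j + 2) m) * q * p := by
        rw [hp, ← mul_assoc (t R n j - 1), hq]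
        simp only [mul_assoc]
    _ = (1 - simpleElt R n j) * antisymProd R n (j + 2) m * (y * q * p) := by
        rw [hP.eq]
        simp only [mul_assoc]

theorem antisymProd_dvd_prod_commutator {j : ℕ} (hj : j ≤ n) (m : ℕ) (i : Fin m → ℕ)
    (hi : ∀ r, 1 ≤ i r ∧ i r ≤ j) :
    antisymProd R n j m ∣ (List.ofFn (fun r : Fin m =>
      t R n (i r) * t R n j - t R n j * t R n (i r))).prod := by
  induction m with
  | zero => exact one_dvd _
  | succ m ih =>
    rw [List.ofFn_succ, List.prod_cons]
    obtain ⟨x, hx⟩ := ih (fun r => i r.succ) fun r => hi r.succ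
    rw [hx, ← mul_assoc]
    exact (antisymProd_dvd_commutator_mul R (hi 0).1 (hi 0).2 hj m).mul_right x

end GroupAlgebra



theorem somewhere_to_below_right_bound_product
    (R : Type*) [CommRing R] (n : ℕ) (hn : 0 < n)
    (j : ℕ) (hj1 : 1 ≤ j) (hjn : j ≤ n)
    (m : ℕ) (hm : 2 * m ≥ n - j + 2)
    (i : Fin m → ℕ) (hi : ∀ r, 1 ≤ i r ∧ i r ≤ j) :
    (List.ofFn (fun r : Fin m =>
        t R n (i r) * t R n j - t R n j * t R n (i r))).prod = 0 := by
  rw [← zero_dvd_iff, ← antisymProd_eq_zero R (n := n) (a := j) (m := m) (by omega) (by omega)]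
  exact antisymProd_dvd_prod_commutator R hjn m i hi
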